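/- Let n ≥ 2. Then for every digraph D on n vertices without isolated vertices, h(D) ≤ n/2, and equality holds if and only if every arc (u,v) of D satisfies d⁺(u) = d⁻(v) and every vertex w of D satisfies d⁺(w) ≥ 1 and d⁻(w) ≥ 1. -/

import Mathlib

open Finset

/-- The out-degree of a vertex `u` in the digraph on `Fin n` with arc set `A`. -/
def outDeg {n : ℕ} (A : Finset (Fin n × Fin n)) (u : Fin n) : ℕ :=
  (A.filter (fun a => a.1 = u)).card

/-- The in-degree of a vertex `u` in the digraph on `Fin n` with arc set `A`. -/
def inDeg {n : ℕ} (A : Finset (Fin n × Fin n)) (u : Fin n) : ℕ :=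
  (A.filter (fun a => a.2 = u)).card

/-- The vertex-degree-based invariant `I(D) = (1/2) ∑_{uv ∈ A} φ(d⁺(u), d⁻(v))`. -/
noncomputable def vdbI {n : ℕ} (A : Finset (Fin n × Fin n)) (φ : ℕ → ℕ → ℝ) : ℝ :=
  (1 / 2 : ℝ) * ∑ a ∈ A, φ (outDeg A a.1) (inDeg A a.2)

/-- `D` is (isomorphic to) the out-star `K⃗_{1,n-1}`: all arcs from a center `c`. -/
def IsStarOut {n : ℕ} (A : Finset (Fin n × Fin n)) : Prop :=
  ∃ c : Fin n, A = Finset.univ.filter (fun a => a.1 = c ∧ a.2 ≠ c)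

/-- `D` is (isomorphic to) the in-star `K⃗_{n-1,1}`: all arcs into a center `c`. -/
def IsStarIn {n : ℕ} (A : Finset (Fin n × Fin n)) : Prop :=
  ∃ c : Fin n, A = Finset.univ.filter (fun a => a.2 = c ∧ a.1 ≠ c)

/-- `D` is the complete symmetric digraph `K⃡_n`: all ordered pairs of distinct vertices. -/
def IsCompleteSym {n : ℕ} (A : Finset (Fin n × Fin n)) : Prop :=
  A = Finset.univ.filter (fun a => a.1 ≠ a.2)

theorem Finset.sum_inv_card_fiber {α β : Type*} [Fintype β] [DecidableEq β] (A : Finset α)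
    (f : α → β) :
    ∑ a ∈ A, ((A.filter (fun b => f b = f a)).card : ℝ)⁻¹ =
      ∑ u : β, if (A.filter (fun b => f b = u)).card = 0 then 0 else 1 := by
  rw [← Finset.sum_fiberwise A f]
  refine Finset.sum_congr rfl fun u _ => ?_
  have h : ∑ a ∈ A with f a = u, ((A.filter (fun b => f b = f a)).card : ℝ)⁻¹ =
      ∑ a ∈ A with f a = u, ((A.filter (fun b => f b = u)).card : ℝ)⁻¹ :=
    Finset.sum_congr rfl fun a ha => by rw [(Finset.mem_filter.mp ha).2]
  rw [h, Finset.sum_const, nsmul_eq_mul]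
  split_ifs with h0
  · simp [h0]
  · exact mul_inv_cancel₀ (Nat.cast_ne_zero.mpr h0)

theorem two_div_add_le_inv_add_inv {x y : ℝ} (hx : 0 < x) (hy : 0 < y) :
    2 / (x + y) ≤ (x⁻¹ + y⁻¹) / 2 := by
  have h : (x⁻¹ + y⁻¹) / 2 - 2 / (x + y) = (x - y) ^ 2 / (2 * x * y * (x + y)) := by
    field_simp
    ring
  have : 0 ≤ (x - y) ^ 2 / (2 * x * y * (x + y)) := by positivity
  linarith

theorem two_div_add_eq_inv_add_inv_iff {x y : ℝ} (hx : 0 < x) (hy : 0 < y) :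
    2 / (x + y) = (x⁻¹ + y⁻¹) / 2 ↔ x = y := by
  have h : (x⁻¹ + y⁻¹) / 2 - 2 / (x + y) = (x - y) ^ 2 / (2 * x * y * (x + y)) := by
    field_simp
    ring
  rw [eq_comm, ← sub_eq_zero, h, div_eq_zero_iff, or_iff_left (by positivity),
    sq_eq_zero_iff, sub_eq_zero]

theorem outDeg_pos {n : ℕ} {A : Finset (Fin n × Fin n)} {a : Fin n × Fin n} (ha : a ∈ A) :
    0 < outDeg A a.1 :=
  Finset.card_pos.mpr ⟨a, Finset.mem_filter.mpr ⟨ha, rfl⟩⟩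

theorem inDeg_pos {n : ℕ} {A : Finset (Fin n × Fin n)} {a : Fin n × Fin n} (ha : a ∈ A) :
    0 < inDeg A a.2 :=
  Finset.card_pos.mpr ⟨a, Finset.mem_filter.mpr ⟨ha, rfl⟩⟩

theorem stmt18 (n : ℕ) (hn : 2 ≤ n)
    (A : Finset (Fin n × Fin n)) (harc : ∀ a ∈ A, a.1 ≠ a.2)
    (hni : ∀ u : Fin n, outDeg A u ≠ 0 ∨ inDeg A u ≠ 0) :
    vdbI A (fun x y => 2 / ((x : ℝ) + (y : ℝ))) ≤ (n : ℝ) / 2 ∧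
      (vdbI A (fun x y => 2 / ((x : ℝ) + (y : ℝ))) = (n : ℝ) / 2 ↔
        (∀ a ∈ A, outDeg A a.1 = inDeg A a.2) ∧
          ∀ w : Fin n, 1 ≤ outDeg A w ∧ 1 ≤ inDeg A w) := by
  have hle : ∀ a ∈ A, 2 / ((outDeg A a.1 : ℝ) + inDeg A a.2) ≤
      ((outDeg A a.1 : ℝ)⁻¹ + (inDeg A a.2 : ℝ)⁻¹) / 2 := fun a ha =>
    two_div_add_le_inv_add_inv (Nat.cast_pos.mpr (outDeg_pos ha)) (Nat.cast_pos.mpr (inDeg_pos ha))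
  have hS : ∑ a ∈ A, ((outDeg A a.1 : ℝ)⁻¹ + (inDeg A a.2 : ℝ)⁻¹) / 2 =
      ∑ u : Fin n, ((if outDeg A u = 0 then (0 : ℝ) else 1) +
        (if inDeg A u = 0 then (0 : ℝ) else 1)) / 2 := by
    rw [← Finset.sum_div, ← Finset.sum_div, Finset.sum_add_distrib, Finset.sum_add_distrib]
    congr 2
    · exact Finset.sum_inv_card_fiber A Prod.fst
    · exact Finset.sum_inv_card_fiber A Prod.snd
  have hle' : ∀ u ∈ (Finset.univ : Finset (Fin n)), ((if outDeg A u = 0 then (0 : ℝ) else 1) +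
        (if inDeg A u = 0 then (0 : ℝ) else 1)) / 2 ≤ 1 := by
    intro u _
    split_ifs <;> norm_num
  have h₁ := Finset.sum_le_sum hle
  have h₂ := Finset.sum_le_sum hle'
  have e₁ := Finset.sum_eq_sum_iff_of_le hle
  have e₂ := Finset.sum_eq_sum_iff_of_le hle'
  have hn1 : ∑ _u : Fin n, (1 : ℝ) = n := by simp
  rw [hn1] at h₂ e₂
  rw [hS] at h₁ e₁
  have c₁ : (∀ a ∈ A, outDeg A a.1 = inDeg A a.2) ↔
      ∀ a ∈ A, 2 / ((outDeg A a.1 : ℝ) + inDeg A a.2) =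
        ((outDeg A a.1 : ℝ)⁻¹ + (inDeg A a.2 : ℝ)⁻¹) / 2 :=
    forall₂_congr fun a ha => by
      rw [two_div_add_eq_inv_add_inv_iff (Nat.cast_pos.mpr (outDeg_pos ha))
        (Nat.cast_pos.mpr (inDeg_pos ha)), Nat.cast_inj]
  have c₂ : (∀ w : Fin n, 1 ≤ outDeg A w ∧ 1 ≤ inDeg A w) ↔
      ∀ u ∈ (Finset.univ : Finset (Fin n)), ((if outDeg A u = 0 then (0 : ℝ) else 1) +
        (if inDeg A u = 0 then (0 : ℝ) else 1)) / 2 = 1 := by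
    simp only [Finset.mem_univ, true_imp_iff, Nat.one_le_iff_ne_zero]
    refine forall_congr' fun u => ?_
    split_ifs <;> norm_num [*]
  rw [c₁, c₂, ← e₁, ← e₂]
  unfold vdbI
  refine ⟨by linarith, fun h => ⟨by linarith, by linarith⟩, fun ⟨h, h'⟩ => by linarith⟩
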